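/- Let Y₁ and Y₂ be independent real random variables such that Y₁ has probability density f_{m₁,ν₁} and Y₂ has probability density f_{m₂,ν₂} with respect to Lebesgue measure, where m₁, m₂, ν₁, ν₂ > 0 satisfy m₁ − m₂ > ν₂ − ν₁, m₁/ν₁ ≥ m₂/ν₂, m₁ − m₂ + 2ν₁ > 0, and ν₂ > m₁. Then for all 0 < w < 1, A₂ · I(w) ≤ P(Y₁/(Y₁+Y₂) ≤ w) ≤ A₁ · I(w), where I(w) = (1/B(m₁/2, m₂/2)) ∫₀^w t^{m₁/2−1}(1−t)^{m₂/2−1} dt is the regularized incomplete Beta function with parameters m₁/2 and m₂/2. -/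

import Mathlib

open Real MeasureTheory Set ProbabilityTheory

/-- Beta function `B(a,b) = Γ(a)Γ(b)/Γ(a+b)`. -/
noncomputable def Beta (a b : ℝ) : ℝ := Gamma a * Gamma b / Gamma (a + b)

/-- The Fisher–Snedecor F-density with `m` numerator and `ν` denominator degrees of freedom. -/
noncomputable def fDens (m ν : ℝ) (y : ℝ) : ℝ :=
  if 0 < y then
    (1 / Beta (m / 2) (ν / 2)) * (m / ν) ^ (m / 2) * y ^ (m / 2 - 1) *
      (1 + m * y / ν) ^ (-(m + ν) / 2)
  else 0

/-- The constant `A₁`. -/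
noncomputable def A₁ (m₁ m₂ ν₁ ν₂ : ℝ) : ℝ :=
  (m₁ * ν₂ / (m₂ * ν₁)) ^ (m₁ / 2) * Beta ((m₁ + m₂) / 2) ((ν₂ - m₁) / 2) *
    Beta (m₁ / 2) (m₂ / 2) / (Beta (m₁ / 2) (ν₁ / 2) * Beta (m₂ / 2) (ν₂ / 2))

/-- The constant `A₂`. -/
noncomputable def A₂ (m₁ m₂ ν₁ ν₂ : ℝ) : ℝ :=
  2 ^ ((m₁ + m₂) / 2) * (m₂ * ν₁ / (m₁ * ν₂)) ^ (m₂ / 2) *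
    Beta ((m₁ + m₂) / 2) ((m₁ - m₂ + 2 * ν₁) / 2) *
    Beta (m₁ / 2) (m₂ / 2) / (Beta (m₁ / 2) (ν₁ / 2) * Beta (m₂ / 2) (ν₂ / 2))

/-- The regularized incomplete Beta function with parameters `m₁/2`, `m₂/2`. -/
noncomputable def regIncBeta (m₁ m₂ : ℝ) (w : ℝ) : ℝ :=
  (1 / Beta (m₁ / 2) (m₂ / 2)) * ∫ t in (0 : ℝ)..w, t ^ (m₁ / 2 - 1) * (1 - t) ^ (m₂ / 2 - 1)

lemma cov_aux (κ : ℝ) (hκ : 0 < κ) (G : ℝ → ENNReal) :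
    ∫⁻ t in Ioo (0:ℝ) 1, G t =
      ∫⁻ y in Ioi (0:ℝ), ENNReal.ofReal (κ / (1 + κ * y) ^ 2) * G (κ * y / (1 + κ * y)) := by
  have himg : (fun y : ℝ => κ * y / (1 + κ * y)) '' Ioi 0 = Ioo 0 1 := by
    ext t
    simp only [mem_image, mem_Ioi, mem_Ioo]
    constructor
    · rintro ⟨y, hy, rfl⟩
      have : 0 < κ * y := by positivity
      refine ⟨by positivity, ?_⟩
      rw [div_lt_one (by positivity)]; linarith
    · rintro ⟨h0, h1⟩
      have : 0 < 1 - t := by linarith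
      refine ⟨t / (κ * (1 - t)), by positivity, ?_⟩
      have h2 : 1 + κ * (t / (κ * (1 - t))) = 1 / (1 - t) := by
        field_simp; ring
      rw [h2]; field_simp
  rw [← himg, lintegral_image_eq_lintegral_abs_deriv_mul (f' := fun y => κ / (1 + κ * y) ^ 2)
    measurableSet_Ioi]
  · refine setLIntegral_congr_fun measurableSet_Ioi fun y hy => ?_
    have hy : 0 < y := hy
    rw [abs_of_pos (by positivity)]
  · intro y hy
    have hy : 0 < y := hy
    have hne : 1 + κ * y ≠ 0 := by positivity
    have h1 : HasDerivAt (fun y : ℝ => κ * y) κ y := by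
      simpa using (hasDerivAt_id y).const_mul κ
    have := (h1.div (h1.const_add 1) hne).hasDerivWithinAt (s := Ioi 0)
    convert! this using 1
    congr 1; ring
  · intro x hx y hy h
    have hx : 0 < x := hx
    have hy : 0 < y := hy
    replace h : κ * x / (1 + κ * x) = κ * y / (1 + κ * y) := h
    rw [div_eq_div_iff (by positivity) (by positivity)] at h
    have : κ * (x - y) = 0 := by linarith
    rcases mul_eq_zero.1 this with h | h <;> linarith

lemma pow_aux (p q κ y : ℝ) (hκ : 0 < κ) (hy : 0 < y) :
    κ / (1 + κ * y) ^ 2 * ((κ * y / (1 + κ * y)) ^ (p - 1) * (1 - κ * y / (1 + κ * y)) ^ (q - 1))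
      = κ ^ p * (y ^ (p - 1) * (1 + κ * y) ^ (-(p + q))) := by
  have hpos : 0 < 1 + κ * y := by positivity
  have e : 1 - κ * y / (1 + κ * y) = (1 + κ * y)⁻¹ := by field_simp; ring
  rw [e, Real.div_rpow (by positivity) hpos.le, Real.mul_rpow hκ.le hy.le, Real.inv_rpow hpos.le]
  have e1 : κ ^ p = κ ^ (p - 1) * κ := by
    rw [← Real.rpow_add_one hκ.ne']; congr 1; ring
  have e2 : (1 + κ * y) ^ (-(p + q)) =
      ((1 + κ * y) ^ (p - 1))⁻¹ * ((1 + κ * y) ^ (q - 1))⁻¹ * ((1 + κ * y) ^ 2)⁻¹ := by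
    rw [← Real.rpow_natCast, ← Real.rpow_neg hpos.le, ← Real.rpow_neg hpos.le,
      ← Real.rpow_neg hpos.le, ← Real.rpow_add hpos, ← Real.rpow_add hpos]
    congr 1; push_cast; ring
  rw [e1, e2]
  ring

lemma Beta_pos' {a b : ℝ} (ha : 0 < a) (hb : 0 < b) : 0 < Beta a b := beta_pos ha hb

lemma beta_lint (a b : ℝ) (ha : 0 < a) (hb : 0 < b) :
    ∫⁻ t in Ioo (0:ℝ) 1, ENNReal.ofReal (t ^ (a - 1) * (1 - t) ^ (b - 1))
      = ENNReal.ofReal (Beta a b) := by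
  have h := lintegral_betaPDF_eq_one ha hb
  rw [lintegral_betaPDF] at h
  have hB : 0 < Beta a b := Beta_pos' ha hb
  have hB' : beta a b = Beta a b := rfl
  simp_rw [mul_assoc, hB'] at h
  simp_rw [ENNReal.ofReal_mul (one_div_pos.2 hB).le] at h
  rw [lintegral_const_mul _ (by fun_prop)] at h
  calc _ = ENNReal.ofReal (Beta a b) * (ENNReal.ofReal (1 / Beta a b) *
        ∫⁻ t in Ioo (0:ℝ) 1, ENNReal.ofReal (t ^ (a - 1) * (1 - t) ^ (b - 1))) := by
        rw [← mul_assoc, ← ENNReal.ofReal_mul hB.le, mul_one_div_cancel hB.ne']; simp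
    _ = _ := by rw [h, mul_one]

lemma beta_int (p q κ : ℝ) (hp : 0 < p) (hq : 0 < q) (hκ : 0 < κ) :
    ∫⁻ y in Ioi (0:ℝ), ENNReal.ofReal (y ^ (p - 1) * (1 + κ * y) ^ (-(p + q)))
      = ENNReal.ofReal (κ ^ (-p) * Beta p q) := by
  have h := cov_aux κ hκ (fun t => ENNReal.ofReal (t ^ (p - 1) * (1 - t) ^ (q - 1)))
  rw [beta_lint p q hp hq] at h
  rw [ENNReal.ofReal_mul (by positivity), h, ← lintegral_const_mul _ (by fun_prop)]
  refine setLIntegral_congr_fun measurableSet_Ioi fun y hy => ?_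
  have hy : 0 < y := hy
  rw [← ENNReal.ofReal_mul (by positivity), ← ENNReal.ofReal_mul (by positivity),
    pow_aux p q κ y hκ hy, ← mul_assoc, ← Real.rpow_add hκ]
  simp

lemma inc_int (a b w : ℝ) (ha : 0 < a) (hb : 0 < b) (hw0 : 0 < w) (hw1 : w < 1) :
    ∫⁻ u in Ioi (0:ℝ), indicator {u : ℝ | u / (u + 1) ≤ w}
        (fun u => ENNReal.ofReal (u ^ (a - 1) * (1 + u) ^ (-(a + b)))) u
      = ENNReal.ofReal (∫ t in (0:ℝ)..w, t ^ (a - 1) * (1 - t) ^ (b - 1)) := by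
  have h := cov_aux 1 one_pos (indicator (Iic w)
    (fun t => ENNReal.ofReal (t ^ (a - 1) * (1 - t) ^ (b - 1))))
  have hset : Iic w ∩ Ioo 0 1 = Ioc 0 w := by
    ext t; simp only [mem_inter_iff, mem_Iic, mem_Ioo, mem_Ioc]
    constructor
    · rintro ⟨h1, h2, h3⟩; exact ⟨h2, h1⟩
    · rintro ⟨h1, h2⟩; exact ⟨h2, h1, by linarith⟩
  rw [setLIntegral_indicator measurableSet_Iic, hset] at h
  rw [intervalIntegral.integral_of_le hw0.le, ofReal_integral_eq_lintegral_ofReal, h]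
  · refine setLIntegral_congr_fun measurableSet_Ioi fun u hu => ?_
    have hu : 0 < u := hu
    have hx := pow_aux a b 1 u one_pos hu
    simp only [one_mul, Real.one_rpow] at hx ⊢
    by_cases hc : u / (1 + u) ≤ w
    · rw [indicator_of_mem (by simpa [add_comm] using hc), indicator_of_mem (by simpa using hc),
        ← ENNReal.ofReal_mul (by positivity), hx]
    · rw [indicator_of_notMem (by simpa [add_comm] using hc),
        indicator_of_notMem (by simpa using hc), mul_zero]
  · refine ⟨Measurable.aestronglyMeasurable (by fun_prop), ?_⟩
    rw [hasFiniteIntegral_iff_ofReal]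
    · calc _ ≤ ∫⁻ t in Ioo (0:ℝ) 1, ENNReal.ofReal (t ^ (a - 1) * (1 - t) ^ (b - 1)) :=
            lintegral_mono_set (fun t ht => ⟨ht.1, by linarith [ht.2]⟩)
        _ < _ := by rw [beta_lint a b ha hb]; exact ENNReal.ofReal_lt_top
    · refine ae_restrict_of_forall_mem measurableSet_Ioc (fun t ht => ?_)
      have h1 : 0 < t := ht.1
      have h2 : 0 < 1 - t := by linarith [ht.2]
      simp only [Pi.zero_apply]; positivity
  · refine ae_restrict_of_forall_mem measurableSet_Ioc (fun t ht => ?_)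
    have h1 : 0 < t := ht.1
    have h2 : 0 < 1 - t := by linarith [ht.2]
    simp only [Pi.zero_apply]; positivity

lemma scale_aux (y : ℝ) (hy : 0 < y) (G : ℝ → ENNReal) :
    ∫⁻ x in Ioi (0:ℝ), G x = ∫⁻ u in Ioi (0:ℝ), ENNReal.ofReal y * G (u * y) := by
  have himg : (fun u : ℝ => u * y) '' Ioi 0 = Ioi 0 := by
    ext t
    simp only [mem_image, mem_Ioi]
    constructor
    · rintro ⟨u, hu, rfl⟩; positivity
    · intro h; exact ⟨t / y, by positivity, by field_simp⟩
  conv_lhs => rw [← himg]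
  rw [lintegral_image_eq_lintegral_abs_deriv_mul (f' := fun _ => y) measurableSet_Ioi]
  · simp [abs_of_pos hy]
  · intro u _
    simpa using ((hasDerivAt_id u).mul_const y).hasDerivWithinAt (s := Ioi 0)
  · intro x _ z _ h
    exact mul_right_cancel₀ hy.ne' h

lemma meas_fDens (m ν : ℝ) : Measurable (fDens m ν) := by
  unfold fDens
  exact Measurable.ite measurableSet_Ioi (by fun_prop) (by fun_prop)

lemma fDens_nonneg (m ν y : ℝ) (hm : 0 < m) (hν : 0 < ν) : 0 ≤ fDens m ν y := by
  unfold fDens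
  split_ifs with h
  · have := Beta_pos' (half_pos hm) (half_pos hν)
    positivity
  · exact le_rfl

lemma lint_Ioi (F : ℝ → ENNReal) (hF : ∀ x ≤ 0, F x = 0) :
    ∫⁻ x, F x = ∫⁻ x in Ioi (0:ℝ), F x := by
  rw [← lintegral_add_compl _ measurableSet_Ioi, compl_Ioi,
    setLIntegral_eq_zero measurableSet_Iic (fun x hx => hF x hx), add_zero]

lemma prob_eq {Ω : Type*} [MeasureSpace Ω] [IsProbabilityMeasure (ℙ : Measure Ω)]
    (Y₁ Y₂ : Ω → ℝ) (hY₁m : Measurable Y₁) (hY₂m : Measurable Y₂)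
    (hindep : IndepFun Y₁ Y₂ ℙ) (f g : ℝ → ℝ) (hf : Measurable f) (hg : Measurable g)
    (hf0 : ∀ x, 0 ≤ f x) (hfz : ∀ x ≤ 0, f x = 0) (hgz : ∀ x ≤ 0, g x = 0)
    (hY₁ : Measure.map Y₁ ℙ = volume.withDensity (fun y => ENNReal.ofReal (f y)))
    (hY₂ : Measure.map Y₂ ℙ = volume.withDensity (fun y => ENNReal.ofReal (g y)))
    (w : ℝ) :
    ℙ {ω | Y₁ ω / (Y₁ ω + Y₂ ω) ≤ w} =
      ∫⁻ u in Ioi (0:ℝ), indicator {u : ℝ | u / (u + 1) ≤ w}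
        (fun u => ∫⁻ y in Ioi (0:ℝ), ENNReal.ofReal (y * f (u * y) * g y)) u := by
  have hS : MeasurableSet {z : ℝ × ℝ | z.1 / (z.1 + z.2) ≤ w} :=
    measurableSet_le (by fun_prop) measurable_const
  have hT : MeasurableSet {u : ℝ | u / (u + 1) ≤ w} :=
    measurableSet_le (by fun_prop) measurable_const
  have hmap := (indepFun_iff_map_prod_eq_prod_map_map hY₁m.aemeasurable hY₂m.aemeasurable).1 hindep
  have e1 : ℙ {ω | Y₁ ω / (Y₁ ω + Y₂ ω) ≤ w} =
      (Measure.map (fun ω => (Y₁ ω, Y₂ ω)) ℙ) {z : ℝ × ℝ | z.1 / (z.1 + z.2) ≤ w} := by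
    rw [Measure.map_apply (by fun_prop) hS]; rfl
  rw [e1, hmap, hY₁, hY₂, prod_withDensity (by fun_prop) (by fun_prop), withDensity_apply _ hS,
    ← lintegral_indicator hS, lintegral_prod_symm' _ (Measurable.indicator (by fun_prop) hS)]
  rw [lint_Ioi]
  swap
  · intro y hy
    rw [lintegral_eq_zero_iff' (Measurable.aemeasurable ?_)]
    · refine Filter.Eventually.of_forall fun x => ?_
      simp only [indicator, hgz y hy]; simp
    · exact (Measurable.indicator (f := fun z : ℝ × ℝ => ENNReal.ofReal (f z.1) * ENNReal.ofReal (g z.2)) (by fun_prop) hS).comp (measurable_prodMk_right)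
  have e2 : ∀ y ∈ Ioi (0:ℝ), ∫⁻ x, indicator {z : ℝ × ℝ | z.1 / (z.1 + z.2) ≤ w}
      (fun z => ENNReal.ofReal (f z.1) * ENNReal.ofReal (g z.2)) (x, y) =
      ∫⁻ u in Ioi (0:ℝ), indicator {u : ℝ | u / (u + 1) ≤ w}
        (fun u => ENNReal.ofReal (y * f (u * y) * g y)) u := by
    intro y hy
    have hy : 0 < y := hy
    rw [lint_Ioi _ (fun x hx => by simp [indicator, hfz x hx]), scale_aux y hy]
    refine setLIntegral_congr_fun measurableSet_Ioi fun u hu => ?_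
    have hu : 0 < u := hu
    have e : u * y / (u * y + y) = u / (u + 1) := by
      field_simp
    simp only [indicator, mem_ofPred_eq, e]
    split_ifs
    · rw [ENNReal.ofReal_mul (mul_nonneg hy.le (hf0 _)), ENNReal.ofReal_mul hy.le, mul_assoc]
    · simp
  rw [setLIntegral_congr_fun measurableSet_Ioi e2, lintegral_lintegral_swap]
  · refine lintegral_congr fun u => ?_
    by_cases h : u / (u + 1) ≤ w
    · simp [indicator, h]
    · simp [indicator, h]
  · refine Measurable.aemeasurable ?_
    have : Measurable (indicator {z : ℝ × ℝ | z.2 / (z.2 + 1) ≤ w}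
      (fun z : ℝ × ℝ => ENNReal.ofReal (z.1 * f (z.2 * z.1) * g z.1))) :=
      Measurable.indicator (by fun_prop) (measurableSet_le (by fun_prop) measurable_const)
    exact this


lemma dens_prod (m₁ m₂ ν₁ ν₂ u y : ℝ) (hu : 0 < u) (hy : 0 < y) :
    y * fDens m₁ ν₁ (u * y) * fDens m₂ ν₂ y =
      ((1 / Beta (m₁ / 2) (ν₁ / 2)) * (m₁ / ν₁) ^ (m₁ / 2) *
        ((1 / Beta (m₂ / 2) (ν₂ / 2)) * (m₂ / ν₂) ^ (m₂ / 2)) * u ^ (m₁ / 2 - 1)) *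
      (y ^ ((m₁ + m₂) / 2 - 1) * ((1 + m₁ / ν₁ * u * y) ^ (-((m₁ + ν₁) / 2)) *
        (1 + m₂ / ν₂ * y) ^ (-((m₂ + ν₂) / 2)))) := by
  have huy : 0 < u * y := by positivity
  unfold fDens
  rw [if_pos huy, if_pos hy, Real.mul_rpow hu.le hy.le]
  have e : y ^ ((m₁ + m₂) / 2 - 1) = y * y ^ (m₁ / 2 - 1) * y ^ (m₂ / 2 - 1) := by
    nth_rewrite 2 [← Real.rpow_one y]
    rw [← Real.rpow_add hy, ← Real.rpow_add hy]
    congr 1; ring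
  rw [e, neg_div, neg_div, show m₁ * (u * y) / ν₁ = m₁ / ν₁ * u * y by ring,
    show m₂ * y / ν₂ = m₂ / ν₂ * y by ring]
  ring

lemma upper_pt (α β r s u y : ℝ) (hβ : 0 < β) (hαβ : β ≤ α) (hs : 0 < s) (hsr : s ≤ r)
    (hu : 0 < u) (hy : 0 < y) :
    (1 + α * u * y) ^ (-r) * (1 + β * y) ^ (-s) ≤ (1 + β * (1 + u) * y) ^ (-s) := by
  have hα : 0 < α := hβ.trans_le hαβ
  have h1 : (1 + α * u * y) ^ (-r) ≤ (1 + α * u * y) ^ (-s) := by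
    apply Real.rpow_le_rpow_of_exponent_le _ (by linarith)
    have : 0 < α * u * y := by positivity
    linarith
  calc _ ≤ (1 + α * u * y) ^ (-s) * (1 + β * y) ^ (-s) := by gcongr
    _ = ((1 + α * u * y) * (1 + β * y)) ^ (-s) := by
        rw [Real.mul_rpow (by positivity) (by positivity)]
    _ ≤ _ := by
        apply Real.rpow_le_rpow_of_nonpos (by positivity) _ (by linarith)
        have h3 : β * u * y ≤ α * u * y := by gcongr
        have h4 : 0 < α * u * y * (β * y) := by positivity
        nlinarith

lemma lower_pt (α β r s u y : ℝ) (hβ : 0 < β) (hαβ : β ≤ α) (hs : 0 < s) (hsr : s ≤ r)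
    (hu : 0 < u) (hy : 0 < y) :
    (1 + α / 2 * (1 + u) * y) ^ (-(2 * r)) ≤ (1 + α * u * y) ^ (-r) * (1 + β * y) ^ (-s) := by
  have hα : 0 < α := hβ.trans_le hαβ
  have h1 : (1 + β * y) ^ (-r) ≤ (1 + β * y) ^ (-s) := by
    apply Real.rpow_le_rpow_of_exponent_le _ (by linarith)
    have : 0 < β * y := by positivity
    linarith
  have e : (1 + α / 2 * (1 + u) * y) ^ (-(2 * r)) = ((1 + α / 2 * (1 + u) * y) ^ 2) ^ (-r) := by
    rw [← Real.rpow_natCast, ← Real.rpow_mul (by positivity)]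
    congr 1; push_cast; ring
  calc _ ≤ ((1 + α * u * y) * (1 + β * y)) ^ (-r) := by
        rw [e]
        apply Real.rpow_le_rpow_of_nonpos (by positivity) _ (by linarith)
        have h3 : (1 + α * u * y) * (1 + β * y) ≤ (1 + α * u * y) * (1 + α * y) := by gcongr
        nlinarith [sq_nonneg (α * u * y - α * y)]
    _ = (1 + α * u * y) ^ (-r) * (1 + β * y) ^ (-r) := by
        rw [Real.mul_rpow (by positivity) (by positivity)]
    _ ≤ _ := by gcongr

/-- The CDF of `W = Y₁/(Y₁+Y₂)` is bracketed by multiples of the regularized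
incomplete Beta function: `A₂ I(w) ≤ P(W ≤ w) ≤ A₁ I(w)`. -/
theorem cdf_of_W_bounds
    {Ω : Type*} [MeasureSpace Ω] [IsProbabilityMeasure (ℙ : Measure Ω)]
    (Y₁ Y₂ : Ω → ℝ) (hY₁m : Measurable Y₁) (hY₂m : Measurable Y₂)
    (hindep : IndepFun Y₁ Y₂ ℙ)
    (m₁ m₂ ν₁ ν₂ : ℝ) (hm₁ : 0 < m₁) (hm₂ : 0 < m₂) (hν₁ : 0 < ν₁) (hν₂ : 0 < ν₂)
    (h1 : ν₂ - ν₁ < m₁ - m₂) (h2 : m₂ / ν₂ ≤ m₁ / ν₁)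
    (h3 : 0 < m₁ - m₂ + 2 * ν₁) (h4 : m₁ < ν₂)
    (hY₁ : Measure.map Y₁ ℙ = volume.withDensity (fun y => ENNReal.ofReal (fDens m₁ ν₁ y)))
    (hY₂ : Measure.map Y₂ ℙ = volume.withDensity (fun y => ENNReal.ofReal (fDens m₂ ν₂ y)))
    (w : ℝ) (hw0 : 0 < w) (hw1 : w < 1) :
    A₂ m₁ m₂ ν₁ ν₂ * regIncBeta m₁ m₂ w ≤
        (ℙ {ω | Y₁ ω / (Y₁ ω + Y₂ ω) ≤ w}).toReal ∧
      (ℙ {ω | Y₁ ω / (Y₁ ω + Y₂ ω) ≤ w}).toReal ≤ A₁ m₁ m₂ ν₁ ν₂ * regIncBeta m₁ m₂ w := by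
  have hα : 0 < m₁ / ν₁ := by positivity
  have hβ : 0 < m₂ / ν₂ := by positivity
  have hB1 := Beta_pos' (half_pos hm₁) (half_pos hν₁)
  have hB2 := Beta_pos' (half_pos hm₂) (half_pos hν₂)
  have hB := Beta_pos' (half_pos hm₁) (half_pos hm₂)
  have hp : 0 < (m₁ + m₂) / 2 := by positivity
  have hq1 : 0 < (ν₂ - m₁) / 2 := by linarith
  have hq2 : 0 < (m₁ - m₂ + 2 * ν₁) / 2 := by linarith
  have hBq1 := Beta_pos' hp hq1
  have hBq2 := Beta_pos' hp hq2
  have hP := prob_eq Y₁ Y₂ hY₁m hY₂m hindep _ _ (meas_fDens m₁ ν₁) (meas_fDens m₂ ν₂)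
    (fun x => fDens_nonneg m₁ ν₁ x hm₁ hν₁) (fun x hx => if_neg (not_lt.2 hx))
    (fun x hx => if_neg (not_lt.2 hx)) hY₁ hY₂ w
  have hI := inc_int (m₁ / 2) (m₂ / 2) w (half_pos hm₁) (half_pos hm₂) hw0 hw1
  have hI0 : 0 ≤ ∫ t in (0:ℝ)..w, t ^ (m₁ / 2 - 1) * (1 - t) ^ (m₂ / 2 - 1) := by
    apply intervalIntegral.integral_nonneg hw0.le
    intro t ht
    have h1 : 0 ≤ t := ht.1
    have h2 : 0 ≤ 1 - t := by linarith [ht.2]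
    positivity
  have hT : MeasurableSet {u : ℝ | u / (u + 1) ≤ w} :=
    measurableSet_le (by fun_prop) measurable_const
  set C := (1 / Beta (m₁ / 2) (ν₁ / 2)) * (m₁ / ν₁) ^ (m₁ / 2) *
        ((1 / Beta (m₂ / 2) (ν₂ / 2)) * (m₂ / ν₂) ^ (m₂ / 2)) with hC
  have hC0 : 0 < C := by positivity
  -- inner comparison integral
  have inner : ∀ κ q u : ℝ, 0 < κ → 0 < q → 0 < u →
      ∫⁻ y in Ioi (0:ℝ), ENNReal.ofReal (C * u ^ (m₁ / 2 - 1) *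
        (y ^ ((m₁ + m₂) / 2 - 1) * (1 + κ * (1 + u) * y) ^ (-((m₁ + m₂) / 2 + q)))) =
      ENNReal.ofReal (C * κ ^ (-((m₁ + m₂) / 2)) * Beta ((m₁ + m₂) / 2) q) *
        ENNReal.ofReal (u ^ (m₁ / 2 - 1) * (1 + u) ^ (-(m₁ / 2 + m₂ / 2))) := by
    intro κ q u hκ hq hu
    have hBq := Beta_pos' hp hq
    simp_rw [ENNReal.ofReal_mul (show 0 ≤ C * u ^ (m₁ / 2 - 1) by positivity)]
    rw [lintegral_const_mul _ (by fun_prop),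
      beta_int _ q (κ * (1 + u)) hp hq (by positivity), ← ENNReal.ofReal_mul (by positivity),
      ← ENNReal.ofReal_mul (by positivity), Real.mul_rpow hκ.le (by positivity)]
    congr 1
    rw [show -((m₁ + m₂) / 2) = -(m₁ / 2 + m₂ / 2) by ring]
    ring
  have outer : ∀ K : ℝ, 0 ≤ K → ∫⁻ u in Ioi (0:ℝ), indicator {u : ℝ | u / (u + 1) ≤ w}
      (fun u => ENNReal.ofReal K *
        ENNReal.ofReal (u ^ (m₁ / 2 - 1) * (1 + u) ^ (-(m₁ / 2 + m₂ / 2)))) u =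
      ENNReal.ofReal (K * ∫ t in (0:ℝ)..w, t ^ (m₁ / 2 - 1) * (1 - t) ^ (m₂ / 2 - 1)) := by
    intro K hK
    rw [ENNReal.ofReal_mul hK, ← hI,
      ← lintegral_const_mul _ (Measurable.indicator (by fun_prop) hT)]
    refine lintegral_congr fun u => ?_
    by_cases h : u / (u + 1) ≤ w
    · simp [indicator, h]
    · simp [indicator, h]
  have hr : (m₂ + ν₂) / 2 ≤ (m₁ + ν₁) / 2 := by linarith
  have hs : 0 < (m₂ + ν₂) / 2 := by linarith
  constructor
  · have key : ENNReal.ofReal (A₂ m₁ m₂ ν₁ ν₂ * regIncBeta m₁ m₂ w) ≤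
        ℙ {ω | Y₁ ω / (Y₁ ω + Y₂ ω) ≤ w} := by
      have eA : A₂ m₁ m₂ ν₁ ν₂ * regIncBeta m₁ m₂ w =
          (C * (m₁ / ν₁ / 2) ^ (-((m₁ + m₂) / 2)) *
            Beta ((m₁ + m₂) / 2) ((m₁ - m₂ + 2 * ν₁) / 2)) *
          ∫ t in (0:ℝ)..w, t ^ (m₁ / 2 - 1) * (1 - t) ^ (m₂ / 2 - 1) := by
        unfold A₂ regIncBeta
        have e1 : m₂ * ν₁ / (m₁ * ν₂) = (m₂ / ν₂) / (m₁ / ν₁) := by field_simp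
        have e2 : (m₁ / ν₁ / 2) ^ (-((m₁ + m₂) / 2)) =
            2 ^ ((m₁ + m₂) / 2) * (((m₁ / ν₁) ^ (m₁ / 2))⁻¹ * ((m₁ / ν₁) ^ (m₂ / 2))⁻¹) := by
          rw [Real.rpow_neg (by positivity), Real.div_rpow hα.le (by norm_num), inv_div,
            add_div, Real.rpow_add hα, div_eq_mul_inv, mul_inv]
        rw [e1, Real.div_rpow hβ.le hα.le, e2, hC]
        field_simp
      rw [eA, ← outer _ (by positivity), hP]
      refine setLIntegral_mono' measurableSet_Ioi fun u hu => ?_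
      refine indicator_le_indicator' fun _ => ?_
      rw [← inner _ _ u (by positivity) hq2 hu]
      refine setLIntegral_mono' measurableSet_Ioi fun y hy => ?_
      have hu : 0 < u := hu
      have hy : 0 < y := hy
      rw [dens_prod m₁ m₂ ν₁ ν₂ u y hu hy]
      apply ENNReal.ofReal_le_ofReal
      have := lower_pt _ _ _ _ u y hβ h2 hs hr hu hy
      rw [show (m₁ + m₂) / 2 + (m₁ - m₂ + 2 * ν₁) / 2 = 2 * ((m₁ + ν₁) / 2) by ring]
      gcongr
    have hfin : ℙ {ω | Y₁ ω / (Y₁ ω + Y₂ ω) ≤ w} ≠ ⊤ := measure_ne_top _ _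
    exact (ENNReal.ofReal_le_iff_le_toReal hfin).1 key
  · have eA : A₁ m₁ m₂ ν₁ ν₂ * regIncBeta m₁ m₂ w =
          (C * (m₂ / ν₂) ^ (-((m₁ + m₂) / 2)) *
            Beta ((m₁ + m₂) / 2) ((ν₂ - m₁) / 2)) *
          ∫ t in (0:ℝ)..w, t ^ (m₁ / 2 - 1) * (1 - t) ^ (m₂ / 2 - 1) := by
      unfold A₁ regIncBeta
      have e1 : m₁ * ν₂ / (m₂ * ν₁) = (m₁ / ν₁) / (m₂ / ν₂) := by field_simp
      have e2 : (m₂ / ν₂) ^ (-((m₁ + m₂) / 2)) =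
          ((m₂ / ν₂) ^ (m₁ / 2))⁻¹ * ((m₂ / ν₂) ^ (m₂ / 2))⁻¹ := by
        rw [Real.rpow_neg (by positivity), add_div, Real.rpow_add hβ, mul_inv]
      rw [e1, Real.div_rpow hα.le hβ.le, e2, hC]
      field_simp
    apply ENNReal.toReal_le_of_le_ofReal
    · rw [eA]; positivity
    rw [eA, ← outer _ (by positivity), hP]
    refine setLIntegral_mono' measurableSet_Ioi fun u hu => ?_
    refine indicator_le_indicator' fun _ => ?_
    rw [← inner _ _ u (by positivity) hq1 hu]
    refine setLIntegral_mono' measurableSet_Ioi fun y hy => ?_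
    have hu : 0 < u := hu
    have hy : 0 < y := hy
    rw [dens_prod m₁ m₂ ν₁ ν₂ u y hu hy]
    apply ENNReal.ofReal_le_ofReal
    have := upper_pt _ _ _ _ u y hβ h2 hs hr hu hy
    rw [show (m₁ + m₂) / 2 + (ν₂ - m₁) / 2 = (m₂ + ν₂) / 2 by ring]
    gcongr
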